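/- arXiv:2006.14015 — 6 statements merged into one kernel-verified Lean document; each statement's English description precedes it below -/
import Mathlib

section
/- Let F be a field, let g₀ ≠ g₁ be two elements of F, let n be an even positive integer, and let M be an n×n matrix over F that is NOT diagonal (there exist k ≠ ℓ with M k ℓ ≠ 0). Consider the following random experiment: choose S uniformly at random among all subsets of Fin n of size n/2; independently choose values a i and b i for each i ∈ Fin n, each uniformly and independently from {g₀, g₁}; set u i = a i if i ∈ S and u i = 0 otherwise, and set v j = b j if j ∉ S and v j = 0 otherwise. Then the probability that uᵀMv ≠ 0 is at least 1/16. -/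
namespace Aux

def flip {n : ℕ} (k : Fin n) (p : Bool) (a : Fin n → Bool) : Fin n → Bool :=
  fun i => xor (a i) (decide (i = k) && p)

theorem flip_flip {n : ℕ} (k : Fin n) (p : Bool) (a : Fin n → Bool) :
    flip k p (flip k p a) = a := by
  funext i; simp [flip]

def Q {F : Type*} [Field F] (g₀ g₁ : F) {n : ℕ} (M : Matrix (Fin n) (Fin n) F)
    (S : Finset (Fin n)) (a b : Fin n → Bool) : F :=
  ∑ i, ∑ j, (if i ∈ S then (if a i then g₁ else g₀) else 0) * M i j *
            (if j ∈ S then 0 else (if b j then g₁ else g₀))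

theorem bilin {F : Type*} [Field F] {n : ℕ} (M : Matrix (Fin n) (Fin n) F)
    (u u' v v' : Fin n → F) (k l : Fin n) (hu : ∀ i, i ≠ k → u i = u' i)
    (hv : ∀ i, i ≠ l → v i = v' i) :
    (∑ i, ∑ j, u i * M i j * v j) - (∑ i, ∑ j, u' i * M i j * v j)
      - (∑ i, ∑ j, u i * M i j * v' j) + (∑ i, ∑ j, u' i * M i j * v' j)
      = (u k - u' k) * M k l * (v l - v' l) := by
  have : (u k - u' k) * M k l * (v l - v' l) =
      ∑ i, ∑ j, (u i - u' i) * M i j * (v j - v' j) := by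
    rw [Finset.sum_eq_single k, Finset.sum_eq_single l]
    · intro j _ hj; simp [hv j hj]
    · simp
    · intro i _ hi; simp [hu i hi]
    · simp
  rw [this, ← Finset.sum_sub_distrib, ← Finset.sum_sub_distrib, ← Finset.sum_add_distrib]
  refine Finset.sum_congr rfl fun i _ => ?_
  rw [← Finset.sum_sub_distrib, ← Finset.sum_sub_distrib, ← Finset.sum_add_distrib]
  refine Finset.sum_congr rfl fun j _ => ?_
  ring

theorem exists_flip {F : Type*} [Field F] (g₀ g₁ : F) (hg : g₀ ≠ g₁) {n : ℕ}
    (M : Matrix (Fin n) (Fin n) F) (S : Finset (Fin n)) (k l : Fin n) (hk : k ∈ S) (hl : l ∉ S)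
    (hM : M k l ≠ 0) (a b : Fin n → Bool) :
    ∃ p q, Q g₀ g₁ M S (flip k p a) (flip l q b) ≠ 0 := by
  by_contra! h
  have h1 := bilin M (fun i => if i ∈ S then (if flip k false a i then g₁ else g₀) else 0)
    (fun i => if i ∈ S then (if flip k true a i then g₁ else g₀) else 0)
    (fun j => if j ∈ S then 0 else (if flip l false b j then g₁ else g₀))
    (fun j => if j ∈ S then 0 else (if flip l true b j then g₁ else g₀)) k l
    (by intro i hi; simp [flip, hi]) (by intro i hi; simp [flip, hi])
  have e1 := h false false
  have e2 := h true false
  have e3 := h false true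
  have e4 := h true true
  simp only [Q] at e1 e2 e3 e4
  rw [e1, e2, e3, e4] at h1
  have hg' : g₁ - g₀ ≠ 0 := sub_ne_zero.mpr hg.symm
  have hg'' : g₀ - g₁ ≠ 0 := sub_ne_zero.mpr hg
  cases hak : a k <;> cases hbl : b l <;> simp [flip, hk, hl, hak, hbl, hM, hg', hg''] at h1

open Classical in
theorem card_good {F : Type*} [Field F] (g₀ g₁ : F) (hg : g₀ ≠ g₁) {n : ℕ}
    (M : Matrix (Fin n) (Fin n) F) (S : Finset (Fin n)) (k l : Fin n) (hk : k ∈ S) (hl : l ∉ S)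
    (hM : M k l ≠ 0) :
    Fintype.card ((Fin n → Bool) × (Fin n → Bool)) ≤
      4 * ((Finset.univ : Finset ((Fin n → Bool) × (Fin n → Bool))).filter
        (fun x => Q g₀ g₁ M S x.1 x.2 ≠ 0)).card := by
  set G := ((Finset.univ : Finset ((Fin n → Bool) × (Fin n → Bool))).filter
        (fun x => Q g₀ g₁ M S x.1 x.2 ≠ 0)) with hG
  have hsub : (Finset.univ : Finset ((Fin n → Bool) × (Fin n → Bool))) ⊆
      (Finset.univ : Finset (Bool × Bool)).biUnion
        (fun r => G.image (fun x => (flip k r.1 x.1, flip l r.2 x.2))) := by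
    rintro ⟨a, b⟩ -
    obtain ⟨p, q, h⟩ := exists_flip g₀ g₁ hg M S k l hk hl hM a b
    simp only [Finset.mem_biUnion, Finset.mem_image]
    exact ⟨(p, q), Finset.mem_univ _, (flip k p a, flip l q b), by simpa [hG] using h,
      by simp [flip_flip]⟩
  calc _ ≤ _ := Finset.card_le_card hsub
    _ ≤ (Finset.univ : Finset (Bool × Bool)).card * G.card :=
        Finset.card_biUnion_le_card_mul _ _ _ (fun r _ => Finset.card_image_le)
    _ = _ := by simp

theorem card_sets {n : ℕ} (hev : Even n) (k l : Fin n) (hkl : k ≠ l) :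
    ((Finset.univ : Finset (Fin n)).powersetCard (n / 2)).card ≤
      4 * (((Finset.univ : Finset (Fin n)).powersetCard (n / 2)).filter
        (fun S => k ∈ S ∧ l ∉ S)).card := by
  obtain ⟨m, rfl⟩ := hev
  obtain _ | m := m
  · exact k.elim0
  have e : (m + 1 + (m + 1)) / 2 = m + 1 := by omega
  rw [e]
  have h1 : (((Finset.univ : Finset (Fin (m + 1 + (m + 1)))) \ {k, l}).powersetCard m).card ≤
      (((Finset.univ : Finset (Fin (m + 1 + (m + 1)))).powersetCard (m + 1)).filter
        (fun S => k ∈ S ∧ l ∉ S)).card := by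
    apply Finset.card_le_card_of_injOn (fun S => insert k S)
    · intro S hS
      simp only [Finset.mem_coe,
        Finset.mem_powersetCard, Finset.mem_filter] at hS ⊢
      have hkS : k ∉ S := fun h => by simpa using hS.1 h
      have hlS : l ∉ S := fun h => by simpa using hS.1 h
      refine ⟨⟨Finset.subset_univ _, ?_⟩, Finset.mem_insert_self _ _, ?_⟩
      · rw [Finset.card_insert_of_notMem hkS, hS.2]
      · simp [hlS, hkl.symm]
    · intro S hS T hT h
      simp only [Finset.mem_coe, Finset.mem_powersetCard] at hS hT
      have hkS : k ∉ S := fun h => by simpa using hS.1 h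
      have hkT : k ∉ T := fun h => by simpa using hT.1 h
      have := congrArg (fun U => Finset.erase U k) h
      simpa [Finset.erase_insert, hkS, hkT] using this
  refine le_trans ?_ (Nat.mul_le_mul_left 4 h1)
  rw [Finset.card_powersetCard, Finset.card_powersetCard, Finset.card_univ_sdiff,
    Finset.card_pair hkl, Finset.card_univ, Fintype.card_fin]
  have e2 : m + 1 + (m + 1) - 2 = 2 * m := by omega
  have e3 : m + 1 + (m + 1) = 2 * (m + 1) := by omega
  rw [e2, e3, ← Nat.centralBinom_eq_two_mul_choose, ← Nat.centralBinom_eq_two_mul_choose]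
  have := Nat.succ_mul_centralBinom_succ m
  have h5 : (m + 1) * (m + 1).centralBinom ≤ (m + 1) * (4 * m.centralBinom) := by
    rw [this]; nlinarith
  exact Nat.le_of_mul_le_mul_left h5 (Nat.succ_pos m)

end Aux


theorem stmt1 {F : Type*} [Field F] (g₀ g₁ : F) (hg : g₀ ≠ g₁)
    {n : ℕ} (hn : 0 < n) (hev : Even n)
    (M : Matrix (Fin n) (Fin n) F)
    (hM : ∃ k ℓ : Fin n, k ≠ ℓ ∧ M k ℓ ≠ 0) :
    (1 : ENNReal) / 16 ≤
      (PMF.uniformOfFinset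
          (((Finset.univ : Finset (Fin n)).powersetCard (n / 2)) ×ˢ
            (Finset.univ : Finset ((Fin n → Bool) × (Fin n → Bool))))
          (Finset.nonempty_product.mpr
            ⟨Finset.powersetCard_nonempty.mpr
                (by simpa using Nat.div_le_self n 2),
              Finset.univ_nonempty⟩)).toOuterMeasure
        {ω : Finset (Fin n) × ((Fin n → Bool) × (Fin n → Bool)) |
          (∑ i, ∑ j,
            (if i ∈ ω.1 then (if ω.2.1 i then g₁ else g₀) else 0) * M i j *
            (if j ∈ ω.1 then 0 else (if ω.2.2 j then g₁ else g₀))) ≠ 0} := by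
  classical
  obtain ⟨k, l, hkl, hM⟩ := hM
  rw [PMF.toOuterMeasure_uniformOfFinset_apply]
  set P := (Finset.univ : Finset (Fin n)).powersetCard (n / 2) with hP
  set X := (Finset.univ : Finset ((Fin n → Bool) × (Fin n → Bool))) with hX
  have hne : 0 < (P ×ˢ X).card := Finset.card_pos.mpr (Finset.nonempty_product.mpr
            ⟨Finset.powersetCard_nonempty.mpr
                (by simpa using Nat.div_le_self n 2),
              Finset.univ_nonempty⟩)
  have key : (P ×ˢ X).card ≤ 16 * ((P ×ˢ X).filter
      (fun ω => Aux.Q g₀ g₁ M ω.1 ω.2.1 ω.2.2 ≠ 0)).card := by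
    have h1 := Aux.card_sets hev k l hkl
    set T := P.filter (fun S => k ∈ S ∧ l ∉ S) with hT
    have h2 : T.card * X.card ≤ 4 * ((P ×ˢ X).filter
      (fun ω => Aux.Q g₀ g₁ M ω.1 ω.2.1 ω.2.2 ≠ 0)).card := by
      rw [Finset.card_filter _ (P ×ˢ X), Finset.sum_product, Finset.mul_sum]
      calc T.card * X.card = ∑ S ∈ T, X.card := by simp
        _ ≤ ∑ S ∈ T, 4 * ∑ x ∈ X, (if Aux.Q g₀ g₁ M S x.1 x.2 ≠ 0 then 1 else 0) := by
            refine Finset.sum_le_sum fun S hS => ?_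
            rw [hT, Finset.mem_filter] at hS
            rw [← Finset.card_filter]
            exact Aux.card_good g₀ g₁ hg M S k l hS.2.1 hS.2.2 hM
        _ ≤ _ := Finset.sum_le_sum_of_subset (Finset.filter_subset _ _)
    rw [Finset.card_product]
    calc P.card * X.card ≤ (4 * T.card) * X.card := Nat.mul_le_mul_right _ h1
      _ = 4 * (T.card * X.card) := by ring
      _ ≤ 4 * _ := Nat.mul_le_mul_left 4 h2
      _ = _ := by ring
  rw [ENNReal.le_div_iff_mul_le (Or.inl (by exact_mod_cast hne.ne'))
    (Or.inl (ENNReal.natCast_ne_top _)), one_div, mul_comm, ← div_eq_mul_inv]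
  refine ENNReal.div_le_of_le_mul' ?_
  have key' : ((P ×ˢ X).card : ENNReal) ≤ 16 * (((P ×ˢ X).filter
      (fun ω => Aux.Q g₀ g₁ M ω.1 ω.2.1 ω.2.2 ≠ 0)).card : ENNReal) := by exact_mod_cast key
  refine key'.trans (le_of_eq ?_)
  congr 3
  ext ω
  simp only [Finset.mem_filter]
  exact Iff.rfl
end

section
/- Let M be an n×n real matrix each of whose entries is 0 or 1, and let μ be the product measure on (Fin n → ℝ) of n copies of the standard Gaussian measure. Then for μ-almost every u : Fin n → ℝ, the following holds simultaneously for all column indices i, j: the columns i and j of M are identical (∀ k, M k i = M k j) if and only if Σ_k u k * M k i = Σ_k u k * M k j. -/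
open MeasureTheory ProbabilityTheory

theorem aux_null {n : ℕ} (c : Fin n → ℝ) (k : Fin n) (hk : c k ≠ 0) :
    ∀ᵐ u ∂(Measure.pi fun _ : Fin n => gaussianReal 0 1), ∑ k, u k * c k ≠ 0 := by
  cases n with
  | zero => exact k.elim0
  | succ m =>
    haveI : NullSingletonClass (gaussianReal 0 1) := nullSingletonClass_gaussianReal one_ne_zero
    have hmp := measurePreserving_piFinSuccAbove (fun _ : Fin (m+1) => gaussianReal 0 1) k
    let S : Set (ℝ × (Fin m → ℝ)) := {p | p.1 * c k + ∑ j, p.2 j * c (k.succAbove j) = 0}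
    have hS : MeasurableSet S := by
      apply measurableSet_eq_fun <;> fun_prop
    have h0 : ((gaussianReal 0 1).prod (Measure.pi fun _ : Fin m => gaussianReal 0 1)) S = 0 := by
      rw [Measure.prod_apply_symm hS]
      rw [lintegral_eq_zero_of_ae_eq_zero]
      refine Filter.Eventually.of_forall fun y => ?_
      refine measure_mono_null (t := {-(∑ j, y j * c (k.succAbove j)) / c k}) ?_ (measure_singleton _)
      intro x hx
      have hx' : x * c k + ∑ j, y j * c (k.succAbove j) = 0 := hx
      rw [Set.mem_singleton_iff, eq_div_iff hk]
      linarith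
    have h1 := hmp.measure_preimage hS.nullMeasurableSet
    rw [ae_iff]
    refine measure_mono_null ?_ (h1.trans h0)
    intro u hu
    have hu' : ∑ k, u k * c k = 0 := by simpa using hu
    rw [Fin.sum_univ_succAbove _ k] at hu'
    exact hu'

theorem stmt4 {n : ℕ} (M : Matrix (Fin n) (Fin n) ℝ)
    (h01 : ∀ i j, M i j = 0 ∨ M i j = 1) :
    ∀ᵐ u ∂(Measure.pi fun _ : Fin n => gaussianReal 0 1),
      ∀ i j : Fin n, (∀ k, M k i = M k j) ↔
        (∑ k, u k * M k i) = ∑ k, u k * M k j := by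
  rw [ae_all_iff]
  intro i
  rw [ae_all_iff]
  intro j
  by_cases h : ∀ k, M k i = M k j
  · exact Filter.Eventually.of_forall fun u => by simp [h]
  · obtain ⟨k, hk⟩ := not_forall.mp h
    filter_upwards [aux_null (fun k => M k i - M k j) k (sub_ne_zero.mpr hk)] with u hu
    refine ⟨fun h' => absurd h' h, fun he => absurd ?_ hu⟩
    simp [mul_sub, Finset.sum_sub_distrib, he]
end

section
/- Let n ≥ 1, let M be an n×n matrix over ZMod 2 whose columns are pairwise distinct, let ε be a real number with 0 < ε, and let m be a natural number with (n² : ℝ) / ε ≤ 2^m. Choose u⁽¹⁾, …, u⁽ᵐ⁾ : Fin n → ZMod 2 independently and uniformly at random. Then the probability that there exist column indices i ≠ j such that for every r, Σ_k u⁽ʳ⁾ k * M k i = Σ_k u⁽ʳ⁾ k * M k j, is at most ε. -/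
lemma aux_half {n : ℕ} (a b : Fin n → ZMod 2) (h : a ≠ b) :
    2 * (Finset.univ.filter (fun x : Fin n → ZMod 2 => ∑ k, x k * a k = ∑ k, x k * b k)).card
      ≤ Fintype.card (Fin n → ZMod 2) := by
  classical
  obtain ⟨k0, hk⟩ := Function.ne_iff.mp h
  have h1 := Finset.card_filter_add_card_filter_not (s := (Finset.univ : Finset (Fin n → ZMod 2)))
    (fun x : Fin n → ZMod 2 => ∑ k, x k * a k = ∑ k, x k * b k)
  have h2 : (Finset.univ.filter (fun x : Fin n → ZMod 2 => ∑ k, x k * a k = ∑ k, x k * b k)).card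
      ≤ (Finset.univ.filter
        (fun x : Fin n → ZMod 2 => ¬ ∑ k, x k * a k = ∑ k, x k * b k)).card := by
    refine Finset.card_le_card_of_injOn (fun x => x + Pi.single k0 1) ?_ ?_
    · intro x hx
      have hx' : ∑ k, x k * a k = ∑ k, x k * b k := by simpa using hx
      simp [add_mul, Finset.sum_add_distrib, hx', Pi.single_apply, hk]
    · intro x _ y _ hxy
      exact add_right_cancel hxy
  rw [Finset.card_univ] at h1
  omega

lemma aux_card {n m : ℕ} (M : Matrix (Fin n) (Fin n) (ZMod 2))
    (hcols : ∀ i j : Fin n, i ≠ j → (fun k => M k i) ≠ (fun k => M k j)) :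
    2 ^ m * (Finset.univ.filter (fun u : Fin m → Fin n → ZMod 2 => ∃ i j : Fin n, i ≠ j ∧
        ∀ r : Fin m, ∑ k, u r k * M k i = ∑ k, u r k * M k j)).card
      ≤ n ^ 2 * Fintype.card (Fin m → Fin n → ZMod 2) := by
  classical
  set B : Fin n × Fin n → Finset (Fin m → Fin n → ZMod 2) := fun p =>
    if p.1 ≠ p.2 then Fintype.piFinset (fun _ => Finset.univ.filter
      (fun x : Fin n → ZMod 2 => ∑ k, x k * M k p.1 = ∑ k, x k * M k p.2)) else ∅ with hB
  have hsub : (Finset.univ.filter (fun u : Fin m → Fin n → ZMod 2 => ∃ i j : Fin n, i ≠ j ∧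
        ∀ r : Fin m, ∑ k, u r k * M k i = ∑ k, u r k * M k j)) ⊆ Finset.univ.biUnion B := by
    intro u hu
    obtain ⟨i, j, hij, hr⟩ := (Finset.mem_filter.mp hu).2
    refine Finset.mem_biUnion.mpr ⟨(i, j), Finset.mem_univ _, ?_⟩
    simp [hB, hij, hr]
  have hb : ∀ p, 2 ^ m * (B p).card ≤ Fintype.card (Fin m → Fin n → ZMod 2) := by
    intro p
    by_cases hp : p.1 = p.2
    · simp [hB, hp]
    · have := aux_half _ _ (hcols p.1 p.2 hp)
      simp only [hB, ne_eq, hp, not_false_eq_true, if_true, Fintype.card_piFinset_const]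
      rw [← mul_pow, Fintype.card_fun (α := Fin m), Fintype.card_fin m]
      exact Nat.pow_le_pow_left this m
  calc _ ≤ 2 ^ m * ∑ p, (B p).card :=
        Nat.mul_le_mul_left _ ((Finset.card_le_card hsub).trans Finset.card_biUnion_le)
    _ = ∑ p, 2 ^ m * (B p).card := Finset.mul_sum _ _ _
    _ ≤ ∑ _p : Fin n × Fin n, Fintype.card (Fin m → Fin n → ZMod 2) :=
        Finset.sum_le_sum fun p _ => hb p
    _ = _ := by
        rw [Finset.sum_const, Finset.card_univ, Fintype.card_prod, Fintype.card_fin, smul_eq_mul, sq]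

theorem stmt6 {n m : ℕ} (hn : 1 ≤ n) (M : Matrix (Fin n) (Fin n) (ZMod 2))
    (hcols : ∀ i j : Fin n, i ≠ j → (fun k => M k i) ≠ (fun k => M k j))
    (ε : ℝ) (hε : 0 < ε) (hm : (n ^ 2 : ℝ) / ε ≤ 2 ^ m) :
    (PMF.uniformOfFintype (Fin m → Fin n → ZMod 2)).toOuterMeasure
      {u | ∃ i j : Fin n, i ≠ j ∧
        ∀ r : Fin m, ∑ k, u r k * M k i = ∑ k, u r k * M k j}
      ≤ ENNReal.ofReal ε := by
  classical
  have hc := aux_card (m := m) M hcols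
  rw [PMF.toOuterMeasure_uniformOfFintype_apply]
  rw [← Fintype.card_subtype] at hc
  simp only [Set.coe_setOf]
  have hN : 0 < Fintype.card (Fin m → Fin n → ZMod 2) := Fintype.card_pos
  generalize Fintype.card (Fin m → Fin n → ZMod 2) = N at hc hN ⊢
  have key : ∀ c : ℕ, 2 ^ m * c ≤ n ^ 2 * N → (c : ENNReal) / (N : ENNReal) ≤ ENNReal.ofReal ε := by
    intro c hc
    refine ENNReal.div_le_of_le_mul ?_
    rw [← ENNReal.ofReal_natCast c, ← ENNReal.ofReal_natCast N, ← ENNReal.ofReal_mul hε.le]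
    apply ENNReal.ofReal_le_ofReal
    rw [div_le_iff₀ hε] at hm
    have hc' : (2 : ℝ) ^ m * c ≤ n ^ 2 * N := by exact_mod_cast hc
    have h2 : (0 : ℝ) < 2 ^ m := by positivity
    have h3 := mul_le_mul_of_nonneg_right hm (Nat.cast_nonneg (α := ℝ) N)
    refine le_of_mul_le_mul_left ?_ h2
    linarith
  apply key
  convert hc
end

section
/- Let n ≥ 1 and let x, y : Fin n → Bool. Define 3n×3n matrices A and B over ZMod 2, indexed by Fin n × Fin 3, as block-diagonal matrices whose (i,i)-th 3×3 blocks are: for A, the identity block (entry 1 at (p,q) iff p = q) if x i = true, and the cyclic permutation block with ones exactly at positions (0,2), (1,0), (2,1) if x i = false; for B, the all-zero block if y i = false, and the block with ones exactly at all off-diagonal positions (p ≠ q) if y i = true; all entries of A and B with block indices i ≠ j are 0. Then A + B (addition over ZMod 2) is a permutation matrix, i.e., there exists a permutation σ of Fin n × Fin 3 with A + B equal to the permutation matrix of σ, if and only if there is no index i with x i = true and y i = true. -/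
/-- The `3n × 3n` block-diagonal matrix over `ZMod 2` built from Alice's string `x`:
the `(i,i)`-th `3 × 3` block is the identity if `x i = true`, and the cyclic
permutation block with ones exactly at positions `(0,2)`, `(1,0)`, `(2,1)` if
`x i = false`; off-diagonal blocks are zero. -/
def aliceMatrix {n : ℕ} (x : Fin n → Bool) :
    Matrix (Fin n × Fin 3) (Fin n × Fin 3) (ZMod 2) :=
  Matrix.of fun s t =>
    if s.1 = t.1 then
      (if x s.1 then (if s.2 = t.2 then 1 else 0)
       else (if (s.2, t.2) = ((0 : Fin 3), (2 : Fin 3)) ∨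
                (s.2, t.2) = ((1 : Fin 3), (0 : Fin 3)) ∨
                (s.2, t.2) = ((2 : Fin 3), (1 : Fin 3)) then 1 else 0))
    else 0

/-- The `3n × 3n` block-diagonal matrix over `ZMod 2` built from Bob's string `y`:
the `(i,i)`-th `3 × 3` block is zero if `y i = false`, and has ones exactly at
all off-diagonal positions if `y i = true`; off-diagonal blocks are zero. -/
def bobMatrix {n : ℕ} (y : Fin n → Bool) :
    Matrix (Fin n × Fin 3) (Fin n × Fin 3) (ZMod 2) :=
  Matrix.of fun s t =>
    if s.1 = t.1 then
      (if y s.1 then (if s.2 ≠ t.2 then 1 else 0) else 0)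
    else 0

theorem stmt8 {n : ℕ} (hn : 1 ≤ n) (x y : Fin n → Bool) :
    (∃ σ : Equiv.Perm (Fin n × Fin 3),
        aliceMatrix x + bobMatrix y = σ.permMatrix (ZMod 2)) ↔
      ¬∃ i : Fin n, x i = true ∧ y i = true := by
  constructor
  · rintro ⟨σ, h⟩ ⟨i, hx, hy⟩
    have h0 := congrFun (congrFun h (i, 0)) (i, 0)
    have h1 := congrFun (congrFun h (i, 0)) (i, 1)
    have e0 : σ (i, 0) = (i, 0) := by
      by_contra hc
      simp [aliceMatrix, bobMatrix, hx, hy, PEquiv.toMatrix_apply, Equiv.toPEquiv_apply, hc] at h0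
    simp [aliceMatrix, bobMatrix, hx, hy, PEquiv.toMatrix_apply, Equiv.toPEquiv_apply, e0] at h1
  · intro h
    refine ⟨Equiv.prodCongrRight fun i => Equiv.addRight
      (if x i then (0 : Fin 3) else if y i then 1 else 2), ?_⟩
    ext ⟨i, p⟩ ⟨j, q⟩
    have hi : ¬ (x i = true ∧ y i = true) := fun hh => h ⟨i, hh⟩
    by_cases hij : i = j
    · subst hij
      cases hx : x i <;> cases hy : y i <;>
        simp [hx, hy] at hi <;>
        simp [aliceMatrix, bobMatrix, hx, hy, PEquiv.toMatrix_apply, Equiv.toPEquiv_apply] <;>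
        fin_cases p <;> fin_cases q <;> simp <;> decide
    · simp [aliceMatrix, bobMatrix, PEquiv.toMatrix_apply, Equiv.toPEquiv_apply, hij]
end

section
/- Let n > 10 and let G be a simple graph on the vertex set Fin n with exactly n − 1 edges. Suppose G is not a star, i.e., there is no vertex v such that G.Adj a b holds if and only if (a = v ∧ b ≠ v) ∨ (b = v ∧ a ≠ v). Then there exist vertices v₁ и v₂ with G.degree v₁ > G.degree v₂ and G.degree v₁ − G.degree v₂ < n − 2. -/
theorem stmt10 {n : ℕ} (hn : 10 < n) (G : SimpleGraph (Fin n)) [DecidableRel G.Adj]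
    (hedges : G.edgeFinset.card = n - 1)
    (hstar : ¬∃ v : Fin n, ∀ a b : Fin n,
        G.Adj a b ↔ (a = v ∧ b ≠ v) ∨ (b = v ∧ a ≠ v)) :
    ∃ v₁ v₂ : Fin n, G.degree v₂ < G.degree v₁ ∧
      G.degree v₁ - G.degree v₂ < n - 2 := by
  by_contra hcon
  push Not at hcon
  have hsum := G.sum_degrees_eq_twice_card_edges
  rw [hedges] at hsum
  have hlt : ∀ u, G.degree u < n := fun u => by
    simpa using G.degree_lt_card_verts u
  have hex : ∃ v, n - 2 ≤ G.degree v := by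
    by_contra hno
    push Not at hno
    have heq : ∀ u w, G.degree u = G.degree w := by
      intro u w
      rcases lt_trichotomy (G.degree u) (G.degree w) with h | h | h
      · have := hcon _ _ h; have := hno w; omega
      · exact h
      · have := hcon _ _ h; have := hno u; omega
    have z : Fin n := ⟨0, by omega⟩
    rw [Finset.sum_congr rfl (fun u _ => heq u z)] at hsum
    simp at hsum
    have h2 : n * G.degree z + 2 = n * 2 := by omega
    have : n ∣ 2 := (Nat.dvd_add_right (Dvd.intro _ rfl)).1 (h2 ▸ Dvd.intro _ rfl)
    have := Nat.le_of_dvd (by norm_num) this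
    omega
  obtain ⟨v, hv⟩ := hex
  have hone : ∀ u, u ≠ v → G.degree u ≤ 1 := by
    intro u huv
    have h1 : G.degree u < n - 2 := by
      by_contra h
      push Not at h
      have hsub : G.incidenceFinset u ∪ G.incidenceFinset v ⊆ G.edgeFinset :=
        Finset.union_subset (G.incidenceFinset_subset u) (G.incidenceFinset_subset v)
      have hc := Finset.card_le_card hsub
      have hi : G.incidenceFinset u ∩ G.incidenceFinset v ⊆ {s(u, v)} := by
        intro e he
        have := G.incidenceSet_inter_incidenceSet_subset huv
        simp only [Finset.mem_inter, SimpleGraph.mem_incidenceFinset] at he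
        simpa using this he
      have hi' := Finset.card_le_card hi
      have := Finset.card_union_add_card_inter (G.incidenceFinset u) (G.incidenceFinset v)
      simp only [SimpleGraph.card_incidenceFinset_eq_degree, Finset.card_singleton] at *
      omega
    have := hcon v u (by omega)
    have := hlt v
    omega
  have hdv : G.degree v = n - 1 := by
    rw [← Finset.add_sum_erase _ _ (Finset.mem_univ v)] at hsum
    have := Finset.sum_le_card_nsmul (Finset.univ.erase v) (fun u => G.degree u) 1
      (fun u hu => hone u (Finset.ne_of_mem_erase hu))
    simp at this
    have := hlt v
    omega
  have hadj : ∀ u, u ≠ v → G.Adj v u := by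
    intro u hu
    have hs : G.neighborFinset v ⊆ Finset.univ.erase v := by
      intro w hw
      simp at hw ⊢
      exact hw.ne'
    have := Finset.eq_of_subset_of_card_le hs (by simp [hdv])
    have h : u ∈ G.neighborFinset v := by rw [this]; simp [hu]
    simpa using h
  apply hstar
  refine ⟨v, fun a b => ⟨fun h => ?_, ?_⟩⟩
  · by_cases ha : a = v
    · exact Or.inl ⟨ha, fun hb => h.ne (ha.trans hb.symm)⟩
    · by_cases hb : b = v
      · exact Or.inr ⟨hb, ha⟩
      · exfalso
        have h1 := hone a ha
        rw [← G.card_neighborFinset_eq_degree, Finset.card_le_one] at h1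
        exact hb (h1 b (by simpa using h) v (by simpa using (hadj a ha).symm))
  · rintro (⟨rfl, h⟩ | ⟨rfl, h⟩)
    · exact hadj _ h
    · exact (hadj _ h).symm
end

section
/- Let n ≥ 1 and define vectors u, v : Fin n → ℝ by u i = 3^(i) and v j = 3^(n·j) (using the natural-number values of the indices). Then the map M ↦ uᵀMv = Σ_{i,j} 3^(i + n·j) * M i j is injective on the set of n×n real matrices all of whose entries are 0 or 1: if M and M' both have all entries in {0,1} and Σ_{i,j} 3^(i + n·j) * M i j = Σ_{i,j} 3^(i + n·j) * M' i j, then M = M'. -/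
theorem aux_inj {n : ℕ} : Function.Injective
    (fun p : Fin n × Fin n => (p.1 : ℕ) + n * (p.2 : ℕ)) := by
  rintro ⟨a, b⟩ ⟨c, d⟩ h
  simp only at h
  have hn : 0 < n := a.pos
  have h1 : (a : ℕ) = c := by
    have := congrArg (· % n) h
    simpa [Nat.add_mul_mod_self_left, Nat.mod_eq_of_lt a.2, Nat.mod_eq_of_lt c.2] using this
  have h2 : (b : ℕ) = d := by
    rw [h1] at h
    exact Nat.eq_of_mul_eq_mul_left hn (Nat.add_left_cancel h)
  exact Prod.ext (Fin.ext h1) (Fin.ext h2)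

open Classical in
theorem aux_sum {n : ℕ} (M : Matrix (Fin n) (Fin n) ℝ)
    (hM : ∀ i j, M i j = 0 ∨ M i j = 1) :
    ∑ i : Fin n, ∑ j : Fin n, (3 : ℝ) ^ ((i : ℕ) + n * (j : ℕ)) * M i j
      = ((∑ k ∈ (Finset.univ.filter (fun p : Fin n × Fin n => M p.1 p.2 = 1)).image
          (fun p : Fin n × Fin n => (p.1 : ℕ) + n * (p.2 : ℕ)), 3 ^ k : ℕ) : ℝ) := by
  rw [Finset.sum_image (fun _ _ _ _ h => aux_inj h), Finset.sum_filter, ← Fintype.sum_prod_type']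
  push_cast
  refine Finset.sum_congr rfl fun p _ => ?_
  rcases hM p.1 p.2 with h | h <;> simp [h]

theorem stmt16 {n : ℕ} (hn : 1 ≤ n)
    (M M' : Matrix (Fin n) (Fin n) ℝ)
    (hM : ∀ i j, M i j = 0 ∨ M i j = 1)
    (hM' : ∀ i j, M' i j = 0 ∨ M' i j = 1)
    (h : ∑ i : Fin n, ∑ j : Fin n, (3 : ℝ) ^ ((i : ℕ) + n * (j : ℕ)) * M i j
       = ∑ i : Fin n, ∑ j : Fin n, (3 : ℝ) ^ ((i : ℕ) + n * (j : ℕ)) * M' i j) :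
    M = M' := by
  classical
  rw [aux_sum M hM, aux_sum M' hM'] at h
  have h2 := Finset.image_injective aux_inj
    (Finset.geomSum_injective (n := 3) (by norm_num) (Nat.cast_injective h))
  ext i j
  have h3 := Finset.ext_iff.mp h2 (i, j)
  simp only [Finset.mem_filter, Finset.mem_univ, true_and] at h3
  rcases hM i j with a | a <;> rcases hM' i j with b | b <;> simp_all
end
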